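/- There is no Jordan algebra J over a field k of characteristic ≠ 2 possessing an idempotent e and a nilpotent ideal N such that dim_k N = 3, N^⟨3⟩ ≠ 0, N^⟨4⟩ = 0 (so N has nilpotency type (1,1,1)), N ⊆ J_0(e) + J_{1/2}(e), and dim_k (N ∩ J_{1/2}(e)) = 2. -/

import Mathlib

variable {k : Type*} [Field k] {J : Type*} [NonUnitalNonAssocCommRing J]
  [Module k J] [SMulCommClass k J J] [IsScalarTower k J J]

/-- The Peirce component `J_c(e) = {x ∈ J : e·x = c·x}`, a `k`-subspace of `J`. -/
def peirceComp (e : J) (c : k) : Submodule k J where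
  carrier := {x : J | e * x = c • x}
  add_mem' := by
    intro a b ha hb
    simp only [Set.mem_setOf_eq] at *
    rw [mul_add, ha, hb, smul_add]
  zero_mem' := by simp
  smul_mem' := by
    intro r x hx
    simp only [Set.mem_setOf_eq] at *
    rw [mul_smul_comm, hx, smul_comm]

/-- For subspaces `A, B ⊆ J`, `A·B` is the `k`-subspace spanned by all products `a·b`
with `a ∈ A`, `b ∈ B`. -/
def submoduleMul (A B : Submodule k J) : Submodule k J :=
  Submodule.span k {z : J | ∃ a ∈ A, ∃ b ∈ B, z = a * b}

/-- The descending series of a subspace `N`: `nseries N 0 = N^⟨1⟩ = N` and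
`nseries N m = N^⟨m+1⟩ = N^⟨m⟩·N`. -/
def nseries (N : Submodule k J) : ℕ → Submodule k J
  | 0 => N
  | m + 1 => submoduleMul (nseries N m) N

theorem aux_two (hchar : (2 : k) ≠ 0) (x : J) (h : x + x = 0) : x = 0 := by
  have h2 : (2 : k) • x = 0 := by rw [two_smul, h]
  exact (smul_eq_zero.mp h2).resolve_left hchar

/-- Linearized Jordan identity at an idempotent. -/
theorem aux_lin (hchar : (2 : k) ≠ 0)
    (hJordan : ∀ x y : J, ((x * x) * y) * x = (x * x) * (y * x))
    (e : J) (he : e * e = e) (z : J) :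
    e * (e * (z * z)) + ((e * (e * z)) * z + (e * (e * z)) * z)
      = e * (z * z) + ((e * z) * (e * z) + (e * z) * (e * z)) := by
  have h1 := hJordan (e + z) e
  have h2 := hJordan (e - z) e
  simp only [add_mul, mul_add, sub_mul, mul_sub, he, mul_comm z e, mul_comm (z * z) e,
    mul_comm (e * z) e, mul_comm (e * (z * z)) e, mul_comm (e * (e * z)) e] at h1 h2
  rw [← sub_eq_zero]
  apply aux_two (k := k) hchar
  rw [← sub_eq_zero] at h1 h2
  have h3 : _ + _ = (0 : J) + 0 := congrArg₂ (· + ·) h1 h2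
  rw [add_zero] at h3
  rw [← h3]
  abel

theorem no_type_111_half_dim_two (hchar : (2 : k) ≠ 0)
    (hJordan : ∀ x y : J, ((x * x) * y) * x = (x * x) * (y * x))
    (e : J) (he : e * e = e) (hne : e ≠ 0)
    (N : Submodule k J) (hideal : ∀ x ∈ N, ∀ y : J, x * y ∈ N)
    (hdimN : Module.finrank k ↥N = 3)
    (hN3 : nseries N 2 ≠ ⊥)
    (hN4 : nseries N 3 = ⊥)
    (hsub : N ≤ peirceComp e (0 : k) ⊔ peirceComp e (2⁻¹ : k))
    (hhalf : Module.finrank k ↥(N ⊓ peirceComp e (2⁻¹ : k)) = 2) :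
    False := by
  have hlin := aux_lin hchar hJordan e he
  have htwo := aux_two (J := J) hchar
  have hfin : FiniteDimensional k N := Module.finite_of_finrank_pos (by omega)
  have m0 : ∀ x : J, x ∈ peirceComp e (0 : k) ↔ e * x = 0 := fun x => by
    change e * x = (0 : k) • x ↔ _
    rw [zero_smul]
  have mh : ∀ x : J, x ∈ peirceComp e (2⁻¹ : k) ↔ e * x = (2⁻¹ : k) • x := fun x => Iff.rfl
  have hinv : (2⁻¹ : k) ≠ 0 := inv_ne_zero hchar
  have hideal' : ∀ x ∈ N, ∀ y : J, y * x ∈ N := fun x hx y => by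
    rw [mul_comm]; exact hideal x hx y
  -- decomposition
  have hdec : ∀ x ∈ N, ∃ u ∈ N, ∃ v ∈ N, e * u = 0 ∧ e * v = (2⁻¹ : k) • v ∧ x = u + v := by
    intro x hx
    obtain ⟨u, hu, v, hv, rfl⟩ := Submodule.mem_sup.mp (hsub hx)
    rw [m0] at hu
    rw [mh] at hv
    have hvN : v ∈ N := by
      have h := hideal' _ hx e
      rw [mul_add, hu, hv, zero_add] at h
      exact (Submodule.smul_mem_iff N hinv).mp h
    have huN : u ∈ N := by simpa using N.sub_mem hx hvN
    exact ⟨u, huN, v, hvN, hu, hv, rfl⟩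
  -- an element w of N with e(ew) = ew has ew = 0
  have hkill : ∀ w ∈ N, e * (e * w) = e * w → e * w = 0 := by
    intro w hw h
    obtain ⟨u, hu, v, hv, h0, h1, rfl⟩ := hdec w hw
    simp only [mul_add, h0, h1, zero_add, mul_smul_comm] at h ⊢
    have := congrArg (fun t => (2 : k) • t) h
    simp only [smul_smul, ← mul_assoc, mul_inv_cancel₀ hchar, one_mul, one_smul] at this
    have h4 : v = 0 := by
      apply htwo
      have h5 : (2 : k) • v = v := by
        conv_lhs => rw [← this]
        rw [smul_smul, mul_inv_cancel₀ hchar, one_smul]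
      rw [two_smul] at h5
      have : v = 0 := by simpa using h5
      simp [this]
    simp [h4]
  have h00 : ∀ a ∈ N, e * a = 0 → e * (a * a) = 0 := by
    intro a ha h
    apply hkill _ (hideal _ ha _)
    have := hlin a
    simpa [h] using this
  have hhh : ∀ v ∈ N, e * v = (2⁻¹ : k) • v → e * (v * v) = 0 := by
    intro v hv h
    apply hkill _ (hideal _ hv _)
    have := hlin v
    simpa [h, mul_smul_comm, smul_mul_assoc] using this
  have h0h : ∀ a ∈ N, ∀ v ∈ N, e * a = 0 → e * v = (2⁻¹ : k) • v →
      e * (a * v) = (2⁻¹ : k) • (a * v) := by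
    intro a ha v hv h0 h1
    have H := hlin (a + v)
    simp only [mul_add, add_mul, h0, h1, h00 a ha h0, hhh v hv h1, mul_comm v a, zero_add,
      add_zero, mul_smul_comm, smul_mul_assoc, mul_zero, zero_mul, smul_zero] at H
    obtain ⟨u, hu, q, hq, hu0, hq1, hx⟩ := hdec (a * v) (hideal _ ha _)
    rw [hx] at H ⊢
    simp only [mul_add, hu0, hq1, zero_add, mul_smul_comm, smul_add] at H ⊢
    have hI : (2⁻¹ : k) + 2⁻¹ = 1 := by
      rw [← two_mul, mul_inv_cancel₀ hchar]
    have hu : u = 0 := by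
      have e1 : (2⁻¹ : k) • u = 0 := by
        have : (2⁻¹ : k) * 2⁻¹ + 2⁻¹ * 2⁻¹ = 2⁻¹ := by rw [← mul_add, hI, mul_one]
        have key : (2⁻¹ * 2⁻¹ + 2⁻¹ * 2⁻¹ : k) • u
          + (2⁻¹ * 2⁻¹ + 2⁻¹ * 2⁻¹ - (2⁻¹ + 2⁻¹) + (2⁻¹ * 2⁻¹ + 2⁻¹ * 2⁻¹) : k) • q = 0 := by
          linear_combination (norm := module) H
        rw [this, hI] at key
        have : (2⁻¹ - 1 + 2⁻¹ : k) = 0 := by linear_combination hI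
        simpa [this] using key
      exact (smul_eq_zero.mp e1).resolve_left hinv
    simp [hu]
  have hcube : ∀ v ∈ N, e * v = (2⁻¹ : k) • v → (v * v) * v = 0 := by
    intro v hv h
    have H := hJordan v e
    rw [mul_comm (v * v) e, hhh v hv h, h, zero_mul, mul_smul_comm] at H
    exact (smul_eq_zero.mp H.symm).resolve_left hinv
  have haddh : ∀ v w : J, e * v = (2⁻¹ : k) • v → e * w = (2⁻¹ : k) • w →
      e * (v + w) = (2⁻¹ : k) • (v + w) := by
    intro v w h1 h2
    rw [mul_add, h1, h2, smul_add]
  have hhh' : ∀ v ∈ N, ∀ w ∈ N, e * v = (2⁻¹ : k) • v → e * w = (2⁻¹ : k) • w →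
      e * (v * w) = 0 := by
    intro v hv w hw h1 h2
    have H := hhh (v + w) (N.add_mem hv hw) (haddh v w h1 h2)
    simp only [mul_add, add_mul, hhh v hv h1, hhh w hw h2, mul_comm w v, zero_add, add_zero] at H
    exact htwo _ H
  -- dim N_0 = 1
  have hdim0 : Module.finrank k ↥(N ⊓ peirceComp e (0 : k)) = 1 := by
    have hf1 : FiniteDimensional k ↥(N ⊓ peirceComp e (0 : k)) :=
      Submodule.finiteDimensional_of_le (inf_le_left : _ ≤ N)
    have hf2 : FiniteDimensional k ↥(N ⊓ peirceComp e (2⁻¹ : k)) :=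
      Submodule.finiteDimensional_of_le (inf_le_left : _ ≤ N)
    have H := Submodule.finrank_sup_add_finrank_inf_eq (N ⊓ peirceComp e (0 : k))
      (N ⊓ peirceComp e (2⁻¹ : k))
    have hs : (N ⊓ peirceComp e (0 : k)) ⊔ (N ⊓ peirceComp e (2⁻¹ : k)) = N := by
      apply le_antisymm (sup_le inf_le_left inf_le_left)
      intro x hx
      obtain ⟨u, hu, v, hv, h0, h1, rfl⟩ := hdec x hx
      exact Submodule.add_mem_sup ⟨hu, (m0 u).mpr h0⟩ ⟨hv, h1⟩
    have hi : (N ⊓ peirceComp e (0 : k)) ⊓ (N ⊓ peirceComp e (2⁻¹ : k)) = ⊥ := by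
      rw [eq_bot_iff]
      rintro x ⟨⟨_, h0⟩, _, h1⟩
      have h0 := (m0 x).mp h0
      have h1 := (mh x).mp h1
      rw [h0] at h1
      exact (smul_eq_zero.mp h1.symm).resolve_left hinv
    rw [hs, hi, finrank_bot, hdimN, hhalf] at H
    omega
  obtain ⟨⟨a, haN, ha0⟩, ha_ne, hspan⟩ := finrank_eq_one_iff'.mp hdim0
  replace ha0 := (m0 a).mp ha0
  replace haN : a ∈ N := haN
  have hspan0 : ∀ u ∈ N, e * u = 0 → ∃ c : k, u = c • a := by
    intro u hu h
    obtain ⟨c, hc⟩ := hspan ⟨u, hu, (m0 u).mpr h⟩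
    exact ⟨c, (congrArg Subtype.val hc).symm⟩
  have hane : a ≠ 0 := fun h => ha_ne (Subtype.ext h)
  have hN4' : ∀ x ∈ N, ∀ y ∈ N, ∀ z ∈ N, ∀ w ∈ N, ((x * y) * z) * w = 0 := by
    intro x hx y hy z hz w hw
    have : ((x * y) * z) * w ∈ nseries N 3 :=
      Submodule.subset_span ⟨_, Submodule.subset_span ⟨_, Submodule.subset_span
        ⟨x, hx, y, hy, rfl⟩, z, hz, rfl⟩, w, hw, rfl⟩
    rw [hN4] at this
    exact this
  have haa : a * a = 0 := by
    obtain ⟨c, hc⟩ := hspan0 (a * a) (hideal _ haN _) (h00 a haN ha0)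
    have := hN4' a haN a haN a haN a haN
    simp only [hc, smul_mul_assoc, smul_smul] at this
    rcases smul_eq_zero.mp this with h | h
    · have : c = 0 := by simpa using h
      rw [hc, this, zero_smul]
    · exact absurd h hane
  -- it suffices to show N^3 = 0
  apply hN3
  have hred : (∀ r ∈ N, ∀ s ∈ N, ∀ q ∈ N, (r * s) * q = 0) → nseries N 2 = ⊥ := by
    intro H
    rw [eq_bot_iff]
    apply Submodule.span_le.mpr
    rintro _ ⟨p, hp, q, hq, rfl⟩
    change p * q = 0
    replace hp : p ∈ Submodule.span k {z : J | ∃ a ∈ N, ∃ b ∈ N, z = a * b} := hp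
    induction hp using Submodule.span_induction with
    | mem x hx => obtain ⟨r, hr, s, hs, rfl⟩ := hx; exact H r hr s hs q hq
    | zero => simp
    | add x y _ _ h1 h2 => rw [add_mul, h1, h2, add_zero]
    | smul c x _ h1 => rw [smul_mul_assoc, h1, smul_zero]
  apply hred
  have hdec' : ∀ x ∈ N, ∃ c : k, ∃ v ∈ N, e * v = (2⁻¹ : k) • v ∧ x = c • a + v := by
    intro x hx
    obtain ⟨u, hu, v, hv, h0, h1, rfl⟩ := hdec x hx
    obtain ⟨c, rfl⟩ := hspan0 u hu h0
    exact ⟨c, v, hv, h1, rfl⟩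
  by_cases hV : ∀ v ∈ N, e * v = (2⁻¹ : k) • v → v * v = 0
  · have hV' : ∀ v ∈ N, ∀ w ∈ N, e * v = (2⁻¹ : k) • v → e * w = (2⁻¹ : k) • w → v * w = 0 := by
      intro v hv w hw h1 h2
      have H := hV (v + w) (N.add_mem hv hw) (haddh v w h1 h2)
      simp only [mul_add, add_mul, hV v hv h1, hV w hw h2, mul_comm w v, zero_add, add_zero] at H
      exact htwo _ H
    have hsq : ∀ v ∈ N, e * v = (2⁻¹ : k) • v → a * (a * v) = 0 := by
      let f : Module.End k ↥(N ⊓ peirceComp e (2⁻¹ : k)) :=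
        { toFun := fun v => ⟨a * v.1, hideal _ haN _, h0h a haN v.1 v.2.1 ha0 v.2.2⟩
          map_add' := fun x y => Subtype.ext (mul_add _ _ _)
          map_smul' := fun c x => Subtype.ext (mul_smul_comm _ _ _) }
      intro v hv h1
      have hf2 : FiniteDimensional k ↥(N ⊓ peirceComp e (2⁻¹ : k)) :=
        Submodule.finiteDimensional_of_le (inf_le_left : _ ≤ N)
      have K := Module.End.ker_pow_eq_ker_pow_finrank_of_le (f := f) (m := 3) (by omega)
      rw [hhalf] at K
      have h3 : (⟨v, hv, h1⟩ : ↥(N ⊓ peirceComp e (2⁻¹ : k))) ∈ LinearMap.ker (f ^ 3) := by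
        rw [LinearMap.mem_ker]
        apply Subtype.ext
        change a * (a * (a * v)) = 0
        have := hN4' v hv a haN a haN a haN
        rwa [mul_comm v a, mul_comm _ a, mul_comm _ a] at this
      rw [K, LinearMap.mem_ker] at h3
      exact congrArg Subtype.val h3
    intro r hr s hs q hq
    obtain ⟨α, v, hv, hv1, rfl⟩ := hdec' r hr
    obtain ⟨β, w, hw, hw1, rfl⟩ := hdec' s hs
    obtain ⟨γ, z, hz, hz1, rfl⟩ := hdec' q hq
    have hv2 := hV' _ (hideal _ haN v) z hz (h0h a haN v hv ha0 hv1) hz1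
    have hw2 := hV' _ (hideal _ haN w) z hz (h0h a haN w hw ha0 hw1) hz1
    simp [mul_add, add_mul, smul_mul_assoc, mul_smul_comm, haa, hV' v hv w hw hv1 hw1,
      mul_comm v a, mul_comm _ a, hsq v hv hv1, hsq w hw hw1, hv2, hw2]
  · push Not at hV
    obtain ⟨x, hx, hx1, hxx⟩ := hV
    obtain ⟨μ, hμ⟩ := hspan0 _ (hideal x hx x) (hhh x hx hx1)
    have hμ0 : μ ≠ 0 := by
      rintro rfl
      exact hxx (by rw [hμ, zero_smul])
    have hax : a * x = 0 := by
      have := hcube x hx hx1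
      rw [hμ, smul_mul_assoc] at this
      exact (smul_eq_zero.mp this).resolve_left hμ0
    have hav : ∀ y ∈ N, e * y = (2⁻¹ : k) • y → a * y = 0 := by
      intro y hy hy1
      obtain ⟨b, hb⟩ := hspan0 _ (hideal x hx y) (hhh' x hx y hy hx1 hy1)
      obtain ⟨c, hc⟩ := hspan0 _ (hideal y hy y) (hhh' y hy y hy hy1 hy1)
      have h1 := hcube (x + y) (N.add_mem hx hy) (haddh _ _ hx1 hy1)
      have h2 := hcube y hy hy1
      rw [hc, smul_mul_assoc] at h2
      have h3 := hcube (y - x) (N.sub_mem hy hx) (by rw [mul_sub, hx1, hy1, smul_sub])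
      simp only [mul_add, add_mul, mul_sub, sub_mul, mul_comm y x, hμ, hb, hc, smul_mul_assoc,
        hax, h2, smul_zero, zero_add, add_zero, sub_zero, zero_sub] at h1 h3
      have h4 : μ • (a * y) + μ • (a * y) = 0 := by
        linear_combination (norm := module) h1 + h3
      exact (smul_eq_zero.mp (htwo _ h4)).resolve_left hμ0
    intro r hr s hs q hq
    obtain ⟨α, v, hv, hv1, rfl⟩ := hdec' r hr
    obtain ⟨β, w, hw, hw1, rfl⟩ := hdec' s hs
    obtain ⟨γ, z, hz, hz1, rfl⟩ := hdec' q hq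
    obtain ⟨b, hb⟩ := hspan0 _ (hideal v hv w) (hhh' v hv w hw hv1 hw1)
    simp [mul_add, add_mul, smul_mul_assoc, mul_smul_comm, haa, hb, mul_comm v a,
      hav v hv hv1, hav w hw hw1, hav z hz hz1]
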